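/- arXiv:2411.14238 — 2 statements merged into one kernel-verified Lean document; each statement's English description precedes it below -/
import Mathlib

section
/- Let G be a finite simple bipartite graph on n vertices whose adjacency matrix has spectrum {λ_1, λ_2, …, λ_n} (the multiset of roots of the characteristic polynomial φ(G,x) = det(xI − A(G))). Then G is C_{4k}-free (contains no cycle whose length is divisible by 4) if and only if the multiset of roots of the permanental polynomial π(G,x) = per(xI − A(G)) over the complex numbers is {iλ_1, iλ_2, …, iλ_n}, where i is the imaginary unit. -/
open Polynomial SimpleGraph
open scoped Classical

noncomputable section

/-- The adjacency matrix of a simple graph `G`, with entries in `R`. -/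
def adjMat (R : Type*) [Zero R] [One R] {V : Type*} [Fintype V] (G : SimpleGraph V) :
    Matrix V V R := fun u v => if G.Adj u v then 1 else 0

/-- The characteristic polynomial `det (xI - A(G))` of a simple graph `G`. -/
def charPolyG (R : Type*) [CommRing R] {V : Type*} [Fintype V] (G : SimpleGraph V) : R[X] :=
  (adjMat R G).charpoly

/-- The permanental polynomial `per (xI - A(G))` of a simple graph `G`. -/
def permPolyG (R : Type*) [CommRing R] {V : Type*} [Fintype V] (G : SimpleGraph V) : R[X] :=
  (Matrix.charmatrix (adjMat R G)).permanent

/-- The modified characteristic polynomial `φ_p(G,x) = ∑_{i even} (-1)^{i/2} a_i x^{n-i}`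
of a (bipartite) graph `G` on `n` vertices, where `a_i` is the coefficient of `x^{n-i}`
in the characteristic polynomial. -/
def phiP {V : Type*} [Fintype V] (G : SimpleGraph V) : ℝ[X] :=
  ∑ i ∈ Finset.range (Fintype.card V + 1),
    if Even i then
      C ((-1 : ℝ) ^ (i / 2) * (charPolyG ℝ G).coeff (Fintype.card V - i)) *
        X ^ (Fintype.card V - i)
    else 0

/-- `G` contains no cycle whose length is divisible by 4. -/
def C4kFree {V : Type*} (G : SimpleGraph V) : Prop :=
  ¬ ∃ (v : V) (c : G.Walk v v), c.IsCycle ∧ 4 ∣ c.length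

/-- `G` is `4k`-intercyclic: it contains no two vertex-disjoint cycles,
each of length divisible by 4. -/
def Intercyclic4k {V : Type*} (G : SimpleGraph V) : Prop :=
  ¬ ∃ (u v : V) (c : G.Walk u u) (d : G.Walk v v),
      c.IsCycle ∧ d.IsCycle ∧ 4 ∣ c.length ∧ 4 ∣ d.length ∧
      ∀ x, x ∈ c.support → x ∉ d.support

/-- A subgraph `R` of `G` is a cycle of `G` if it is the subgraph traced by some cycle walk. -/
def IsCycleSubgraph {V : Type*} (G : SimpleGraph V) (R : G.Subgraph) : Prop :=
  ∃ (v : V) (c : G.Walk v v), c.IsCycle ∧ R = c.toSubgraph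

/-- The set of all `4k`-cycles (cycles of length divisible by 4) of `G`,
viewed as subgraphs. -/
def cycles4k {V : Type*} (G : SimpleGraph V) : Set G.Subgraph :=
  {R | ∃ (v : V) (c : G.Walk v v), c.IsCycle ∧ 4 ∣ c.length ∧ R = c.toSubgraph}

/-- The connected component `c` of the subgraph `H` is a single edge (a `K₂`). -/
def IsEdgeComp {V : Type*} {G : SimpleGraph V} (H : G.Subgraph)
    (c : H.coe.ConnectedComponent) : Prop :=
  ∃ x y : H.verts, H.coe.Adj x y ∧ c.supp = {x, y}

/-- The connected component `c` of the subgraph `H` is a cycle: there is a cycle walk whose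
support is exactly `c` and which uses every edge of `H` inside `c`. -/
def IsCycleComp {V : Type*} {G : SimpleGraph V} (H : G.Subgraph)
    (c : H.coe.ConnectedComponent) : Prop :=
  ∃ (v : H.verts) (w : H.coe.Walk v v), w.IsCycle ∧
    {x | x ∈ w.support} = c.supp ∧
    ∀ x y : H.verts, H.coe.Adj x y → x ∈ c.supp → w.toSubgraph.Adj x y

/-- A Sachs subgraph of `G`: a subgraph each of whose connected components is either
a single edge or a cycle. -/
def IsSachs {V : Type*} {G : SimpleGraph V} (H : G.Subgraph) : Prop :=
  ∀ c : H.coe.ConnectedComponent, IsEdgeComp H c ∨ IsCycleComp H c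

/-- The number of connected components of the subgraph `H`. -/
def pCount {V : Type*} {G : SimpleGraph V} (H : G.Subgraph) : ℕ :=
  Nat.card H.coe.ConnectedComponent

/-- The number of components of `H` that are cycles of length divisible by 4. -/
def sCount {V : Type*} {G : SimpleGraph V} (H : G.Subgraph) : ℕ :=
  Set.ncard {c : H.coe.ConnectedComponent | IsCycleComp H c ∧ c.supp.ncard % 4 = 0}

/-- The number of components of `H` that are cycles of length congruent to 2 mod 4. -/
def tCount {V : Type*} {G : SimpleGraph V} (H : G.Subgraph) : ℕ :=
  Set.ncard {c : H.coe.ConnectedComponent | IsCycleComp H c ∧ c.supp.ncard % 4 = 2}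

/-- The number of components of `H` that are cycles. -/
def cycCount {V : Type*} {G : SimpleGraph V} (H : G.Subgraph) : ℕ :=
  Set.ncard {c : H.coe.ConnectedComponent | IsCycleComp H c}

/-- `R` is a union of connected components of `H`. -/
def IsComponentUnion {V : Type*} {G : SimpleGraph V} (R H : G.Subgraph) : Prop :=
  R ≤ H ∧ ∀ x y, H.Adj x y → x ∈ R.verts → R.Adj x y

theorem neg_I_pow_four : (-Complex.I) ^ 4 = 1 := by
  simp [Even.neg_pow (by decide : Even 4)]

/-- Every point moved by `σ` is adjacent in `G` to its image. -/
def MovesAlongEdges {V : Type*} (G : SimpleGraph V) (σ : Equiv.Perm V) : Prop :=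
  ∀ v, σ v ≠ v → G.Adj (σ v) v

section Permutations

open Equiv Equiv.Perm

variable {V : Type*} [Fintype V] {G : SimpleGraph V} {σ : Perm V}

/-- A cycle of length at least three in the cycle type of a permutation moving along edges of `G`
gives a cycle of `G` of the same length. -/
theorem MovesAlongEdges.exists_isCycle (hσ : MovesAlongEdges G σ) {l : ℕ}
    (hl : l ∈ σ.cycleType) (h3 : 2 < l) :
    ∃ (v : V) (p : G.Walk v v), p.IsCycle ∧ p.length = l := by
  rw [← cycleGraph_isContained_iff h3]
  obtain ⟨c, τ, rfl, hd, hc, rfl⟩ := mem_cycleType_iff.1 hl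
  obtain ⟨x, hx⟩ := hc.nonempty_support
  have hon : c.IsCycleOn (c.support : Set V) := by
    simpa [Perm.coe_support_eq_set_support] using hc.isCycleOn
  have hadj : ∀ k : ℕ, G.Adj ((c ^ (k + 1)) x) ((c ^ k) x) := by
    intro k
    have hk : c ((c ^ k) x) ≠ (c ^ k) x :=
      mem_support.1 (pow_apply_mem_support.2 hx)
    have hτ : τ ((c ^ k) x) = (c ^ k) x := (hd _).resolve_left hk
    have := hσ ((c ^ k) x) (by rwa [Perm.mul_apply, hτ])
    rwa [Perm.mul_apply, hτ, ← Perm.mul_apply, ← pow_succ'] at this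
  have key : ∀ u v : Fin c.support.card, (u - v).val = 1 →
      G.Adj ((c ^ u.val) x) ((c ^ v.val) x) := by
    intro u v h
    have hu : (c ^ u.val) x = (c ^ (v.val + 1)) x := by
      rw [hon.pow_apply_eq_pow_apply hx]
      rw [Fin.sub_def] at h
      simp only at h
      have h1 : (c.support.card - v.val + u.val) ≡ 1 [MOD c.support.card] := by
        rw [Nat.ModEq, h, Nat.mod_eq_of_lt (by omega)]
      have h2 := h1.add_left v.val
      rw [show v.val + (c.support.card - v.val + u.val) = c.support.card + u.val by omega] at h2
      simpa [Nat.ModEq] using h2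
    rw [hu]
    exact hadj _
  refine ⟨⟨⟨fun i => (c ^ i.val) x, ?_⟩, ?_⟩⟩
  · intro u v h
    rcases cycleGraph_adj'.1 h with h | h
    · exact key u v h
    · exact (key v u h).symm
  · intro u v h
    have h' := (hon.pow_apply_eq_pow_apply hx).1 h
    exact Fin.ext (Nat.ModEq.eq_of_lt_of_lt h' u.2 v.2)

theorem MovesAlongEdges.even_of_mem_cycleType (hbip : G.Colorable 2) (hσ : MovesAlongEdges G σ)
    {l : ℕ} (hl : l ∈ σ.cycleType) : Even l := by
  rcases (two_le_of_mem_cycleType hl).eq_or_lt with rfl | h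
  · exact even_two
  · obtain ⟨v, p, -, rfl⟩ := hσ.exists_isCycle hl h
    exact two_colorable_iff_forall_loop_even.1 hbip v p

theorem MovesAlongEdges.even_card_support (hbip : G.Colorable 2) (hσ : MovesAlongEdges G σ) :
    Even σ.support.card := by
  rw [← sum_cycleType, even_iff_two_dvd]
  exact Multiset.dvd_sum fun l hl => (hσ.even_of_mem_cycleType hbip hl).two_dvd

theorem MovesAlongEdges.sign_mul_pow_eq_one (hbip : G.Colorable 2) (hfree : C4kFree G)
    (hσ : MovesAlongEdges G σ) :
    ((sign σ : ℤ) : ℂ) * (-Complex.I) ^ σ.support.card = 1 := by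
  have hmod : ∀ l ∈ σ.cycleType, l % 4 = 2 := by
    intro l hl
    have h2 := two_le_of_mem_cycleType hl
    obtain ⟨m, hm⟩ := hσ.even_of_mem_cycleType hbip hl
    by_contra hne
    obtain ⟨v, p, hp, hlen⟩ := hσ.exists_isCycle hl (by omega)
    exact hfree ⟨v, p, hp, by omega⟩
  rw [← sum_cycleType, sign_of_cycleType']
  generalize σ.cycleType = t at hmod
  induction t using Multiset.induction_on with
  | empty => simp
  | cons a s ih =>
    have ha : a % 4 = 2 := hmod a (Multiset.mem_cons_self a s)
    have hs := ih fun l hl => hmod l (Multiset.mem_cons_of_mem hl)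
    obtain ⟨q, hq⟩ : ∃ q, a = 4 * q + 2 := ⟨a / 4, by omega⟩
    have hI : (-Complex.I) ^ a = -1 := by
      rw [hq, pow_add, pow_mul, neg_I_pow_four]
      simp
    have h1 : (-1 : ℤˣ) ^ a = 1 := Even.neg_one_pow ⟨2 * q + 1, by omega⟩
    rw [Multiset.map_cons, Multiset.prod_cons, Multiset.sum_cons, pow_add, hI, h1]
    push_cast at hs ⊢
    linear_combination hs

theorem MovesAlongEdges.sign_mul_pow_eq_one_or (hbip : G.Colorable 2) (hσ : MovesAlongEdges G σ) :
    ((sign σ : ℤ) : ℂ) * (-Complex.I) ^ σ.support.card = 1 ∨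
      ((sign σ : ℤ) : ℂ) * (-Complex.I) ^ σ.support.card = -1 := by
  obtain ⟨m, hm⟩ := hσ.even_card_support hbip
  rw [hm, ← two_mul, pow_mul, neg_sq, Complex.I_sq]
  rcases Int.units_eq_one_or (sign σ) with h | h <;>
    rcases neg_one_pow_eq_or ℂ m with h' | h' <;> simp [h, h']

/-- A cycle of length divisible by four gives a permutation moving along edges whose signed term
is `-1`. -/
theorem exists_movesAlongEdges_of_not_C4kFree (h : ¬ C4kFree G) :
    ∃ σ : Perm V, MovesAlongEdges G σ ∧
      ((sign σ : ℤ) : ℂ) * (-Complex.I) ^ σ.support.card = -1 := by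
  obtain ⟨v, p, hp, k, hk⟩ := not_not.1 h
  have h3 := hp.three_le_length
  obtain ⟨m, hm⟩ : ∃ m, p.length = m + 2 := ⟨p.length - 2, by omega⟩
  obtain ⟨⟨f, hf⟩⟩ := (cycleGraph_isContained_iff (G := G) (n := m + 2) (by omega)).2
    ⟨v, p, hp, hm⟩
  rw [hm] at hk
  let e : Fin (m + 2) ↪ V := ⟨f, hf⟩
  refine ⟨(finRotate (m + 2)).viaFintypeEmbedding e, fun x hx => ?_, ?_⟩
  · by_cases hxr : x ∈ Set.range e
    · obtain ⟨i, rfl⟩ := hxr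
      rw [viaFintypeEmbedding_apply_image]
      refine f.map_adj (cycleGraph_adj.2 (Or.inl ?_))
      rw [finRotate_apply, add_sub_cancel_left]
    · exact absurd (viaFintypeEmbedding_apply_notMem_range _ _ hxr) hx
  · have hcard : ((finRotate (m + 2)).viaFintypeEmbedding e).support.card = m + 2 := by
      rw [← sum_cycleType, viaFintypeEmbedding, cycleType_extendDomain, cycleType_finRotate,
        Multiset.sum_singleton]
    rw [hcard, viaFintypeEmbedding_sign, sign_finRotate, hk, pow_mul,
      neg_I_pow_four, one_pow, mul_one,
      Odd.neg_one_pow (by rw [Nat.odd_iff]; omega)]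
    simp

end Permutations

section Expansions

open Equiv Equiv.Perm

variable {V : Type*} [Fintype V] (G : SimpleGraph V)

theorem prod_charmatrix_smul_adjMat (a : ℂ) (σ : Perm V) :
    ∏ v, Matrix.charmatrix (a • adjMat ℂ G) (σ v) v =
      if MovesAlongEdges G σ then
        C ((-a) ^ σ.support.card) * X ^ (Fintype.card V - σ.support.card) else 0 := by
  split_ifs with hσ
  · have hterm : ∀ v, Matrix.charmatrix (a • adjMat ℂ G) (σ v) v =
        if v ∈ σ.support then C (-a) else X := by
      intro v
      by_cases hv : σ v = v
      · simp [hv, adjMat, Matrix.charmatrix_apply_eq]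
      · simp [hv, adjMat, Matrix.charmatrix_apply_ne, hσ v hv]
    simp_rw [hterm]
    rw [Finset.prod_ite]
    have h1 : (Finset.univ.filter fun v => v ∈ σ.support) = σ.support := by ext; simp
    have h2 : (Finset.univ.filter fun v => v ∉ σ.support) = σ.supportᶜ := by ext; simp
    rw [h1, h2, Finset.prod_const, Finset.prod_const, Finset.card_compl, C_pow]
  · obtain ⟨v, hv, hadj⟩ : ∃ v, σ v ≠ v ∧ ¬ G.Adj (σ v) v := by
      simpa [MovesAlongEdges] using hσ
    exact Finset.prod_eq_zero (Finset.mem_univ v)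
      (by simp [adjMat, Matrix.charmatrix_apply_ne _ _ _ hv, hadj])

theorem permPolyG_eq_sum (hbip : G.Colorable 2) :
    permPolyG ℂ G = ∑ σ : Perm V, if MovesAlongEdges G σ then
      X ^ (Fintype.card V - σ.support.card) else 0 := by
  rw [permPolyG, Matrix.permanent]
  refine Finset.sum_congr rfl fun σ _ => ?_
  have := prod_charmatrix_smul_adjMat G 1 σ
  rw [one_smul] at this
  rw [this]
  refine if_ctx_congr Iff.rfl (fun hσ => ?_) fun _ => rfl
  simp [(hσ.even_card_support hbip).neg_one_pow]

theorem charpoly_I_smul_adjMat_eq_sum :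
    (Complex.I • adjMat ℂ G).charpoly = ∑ σ : Perm V, if MovesAlongEdges G σ then
      C (((sign σ : ℤ) : ℂ) * (-Complex.I) ^ σ.support.card) *
        X ^ (Fintype.card V - σ.support.card) else 0 := by
  rw [Matrix.charpoly, Matrix.det_apply']
  refine Finset.sum_congr rfl fun σ _ => ?_
  rw [prod_charmatrix_smul_adjMat, mul_ite, mul_zero]
  refine if_congr Iff.rfl ?_ rfl
  rw [C_mul, mul_assoc]
  simp

end Expansions

/-- Scaling a matrix by a unit scales the roots of its characteristic polynomial. -/
theorem charpoly_smul_eq_prod {V K : Type*} [Fintype V] [Field K] [Infinite K] (M : Matrix V V K)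
    {a : K} (ha : a ≠ 0) {n : ℕ} (hn : Fintype.card V = n) (lam : Fin n → K)
    (h : M.charpoly = ∏ j, (X - C (lam j))) :
    (a • M).charpoly = ∏ j, (X - C (a * lam j)) := by
  refine Polynomial.funext fun x => ?_
  have hM : Matrix.scalar V x - a • M = a • (Matrix.scalar V (a⁻¹ * x) - M) := by
    ext i j
    by_cases hij : i = j <;> simp [hij, mul_sub, ha]
  have hpow : a ^ n = ∏ _j : Fin n, a := by simp
  rw [Matrix.eval_charpoly, hM, Matrix.det_smul, ← Matrix.eval_charpoly, h, eval_prod, eval_prod,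
    hn, hpow, ← Finset.prod_mul_distrib]
  refine Finset.prod_congr rfl fun j _ => ?_
  simp [mul_sub, ha]

/-- Borowiecki. Let `G` be a bipartite graph on `n` vertices with spectrum
`{λ_1, …, λ_n}`. Then `G` is `C_{4k}`-free iff its per-spectrum is `{iλ_1, …, iλ_n}`, i.e.
iff the (monic, degree `n`) permanental polynomial factors over `ℂ` as `∏ (x - iλ_j)`. -/
theorem stmt_1 {V : Type*} [Fintype V] (G : SimpleGraph V) (hbip : G.Colorable 2)
    (n : ℕ) (hn : Fintype.card V = n) (lam : Fin n → ℝ)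
    (hspec : charPolyG ℂ G = ∏ j : Fin n, (X - C (lam j : ℂ))) :
    C4kFree G ↔ permPolyG ℂ G = ∏ j : Fin n, (X - C (Complex.I * lam j)) := by
  rw [← charpoly_smul_eq_prod (adjMat ℂ G) Complex.I_ne_zero hn (fun j => (lam j : ℂ)) hspec,
    permPolyG_eq_sum G hbip, charpoly_I_smul_adjMat_eq_sum]
  constructor
  · intro hfree
    refine Finset.sum_congr rfl fun σ _ => if_ctx_congr Iff.rfl (fun hσ => ?_) fun _ => rfl
    rw [hσ.sign_mul_pow_eq_one hbip hfree, C_1, one_mul]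
  · intro heq
    by_contra hfree
    obtain ⟨τ, hτ, hτneg⟩ := exists_movesAlongEdges_of_not_C4kFree hfree
    have heval := congrArg (fun p => (eval 1 p).re) heq
    simp only [eval_finsetSum, Complex.re_sum, apply_ite (eval (1 : ℂ)), eval_mul, eval_C,
      eval_pow, eval_X, one_pow, mul_one, eval_zero] at heval
    refine heval.not_gt (Finset.sum_lt_sum (fun σ _ => ?_) ⟨τ, Finset.mem_univ τ, ?_⟩)
    · split_ifs with hσ
      · rcases hσ.sign_mul_pow_eq_one_or hbip with h | h <;> norm_num [h]
      · rfl
    · rw [if_pos hτ, if_pos hτ, hτneg]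
      norm_num

end
end

section
/- Let G be a finite simple bipartite graph on n vertices, and for each nonnegative even integer i let f_i = b_i − (−1)^{i/2} a_i, where a_i and b_i are the coefficients of x^{n−i} in the characteristic polynomial φ(G,x) = det(xI − A(G)) and the permanental polynomial π(G,x) = per(xI − A(G)), respectively. Then f_i = Σ_{j odd} 2^{j+1} Σ_{U_i} 2^{t(U_i)}, where the inner sum is over all Sachs subgraphs U_i of G on i vertices containing exactly j cycles of length divisible by 4, and t(U_i) denotes the number of cycles in U_i whose length is congruent to 2 mod 4. -/
open Polynomial SimpleGraph
open scoped Classical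

noncomputable section

section Permutations

variable {V : Type*}

/-- A permutation moves vertices along edges of `G` if every non-fixed vertex is adjacent to its
image. -/
def MovesAlong (G : SimpleGraph V) (σ : Equiv.Perm V) : Prop :=
  ∀ v, σ v ≠ v → G.Adj (σ v) v

/-- The permutation `σ` traces the subgraph `H`: the vertices of `H` are the vertices moved by `σ`,
and the edges of `H` are the pairs `{v, σ v}` with `σ v ≠ v`. -/
def Traces {G : SimpleGraph V} (σ : Equiv.Perm V) (H : G.Subgraph) : Prop :=
  (∀ v, v ∈ H.verts ↔ σ v ≠ v) ∧ ∀ u v, H.Adj u v ↔ u ≠ v ∧ (σ u = v ∨ σ v = u)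

/-- The subgraph of `G` traced by a permutation. -/
def tracedSubgraph (G : SimpleGraph V) (σ : Equiv.Perm V) : G.Subgraph where
  verts := {v | σ v ≠ v}
  Adj u v := G.Adj u v ∧ (σ u = v ∨ σ v = u)
  adj_sub h := h.1
  edge_vert {u _} h := by
    rcases h with ⟨h, rfl | rfl⟩
    · exact h.ne'
    · exact fun h' => h.ne (σ.injective h')
  symm := ⟨fun _ _ h => ⟨h.1.symm, h.2.symm⟩⟩

theorem Traces.movesAlong {G : SimpleGraph V} {σ : Equiv.Perm V} {H : G.Subgraph}
    (h : Traces σ H) : MovesAlong G σ := fun _ hv =>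
  H.adj_sub ((h.2 _ _).2 ⟨hv, Or.inr rfl⟩)

theorem Traces.eq_tracedSubgraph {G : SimpleGraph V} {σ : Equiv.Perm V} {H : G.Subgraph}
    (h : Traces σ H) : H = tracedSubgraph G σ := by
  ext u v
  · exact h.1 u
  · refine ⟨fun huv => ⟨H.adj_sub huv, ((h.2 u v).1 huv).2⟩, fun huv => ?_⟩
    exact (h.2 u v).2 ⟨huv.1.ne, huv.2⟩

theorem MovesAlong.traces {G : SimpleGraph V} {σ : Equiv.Perm V} (h : MovesAlong G σ) :
    Traces σ (tracedSubgraph G σ) := by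
  refine ⟨fun _ => Iff.rfl, fun u v => ⟨fun huv => ⟨huv.1.ne, huv.2⟩, ?_⟩⟩
  rintro ⟨hne, rfl | rfl⟩
  · exact ⟨(h u hne.symm).symm, Or.inl rfl⟩
  · exact ⟨h v hne, Or.inr rfl⟩

section Coefficients

variable [Fintype V]

theorem prod_charmatrix_adjMat (G : SimpleGraph V) (σ : Equiv.Perm V) :
    ∏ v, Matrix.charmatrix (adjMat ℝ G) (σ v) v =
      if MovesAlong G σ then
        C ((-1 : ℝ) ^ σ.support.card) * X ^ (Fintype.card V - σ.support.card) else 0 := by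
  have hterm : ∀ v, Matrix.charmatrix (adjMat ℝ G) (σ v) v =
      if v ∈ σ.support then C (if G.Adj (σ v) v then (-1 : ℝ) else 0) else X := by
    intro v
    by_cases hv : σ v = v
    · rw [if_neg (by simpa using hv), hv, Matrix.charmatrix_apply_eq]
      simp [adjMat]
    · rw [if_pos (by simpa using hv), Matrix.charmatrix_apply_ne _ _ _ hv]
      by_cases ha : G.Adj (σ v) v <;> simp [adjMat, ha]
  simp_rw [hterm]
  rw [Finset.prod_ite]
  simp only [Finset.prod_const]
  have hfilter : Finset.univ.filter (fun v => v ∈ σ.support) = σ.support := by ext; simp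
  have hcompl : (Finset.univ.filter (fun v => v ∉ σ.support)).card
      = Fintype.card V - σ.support.card := by
    rw [← Finset.card_compl]
    congr 1
    ext
    simp
  rw [hfilter, hcompl]
  split_ifs with h
  · congr 1
    rw [Finset.prod_congr rfl (g := fun _ => C (-1 : ℝ))]
    · simp
    · intro v hv
      rw [if_pos (h v (by simpa using hv))]
  · simp only [MovesAlong, not_forall] at h
    obtain ⟨v, hv, hadj⟩ := h
    rw [Finset.prod_eq_zero (i := v) (by simpa using hv) (by simp [hadj]), zero_mul]

theorem coeff_prod_charmatrix_adjMat (G : SimpleGraph V) (σ : Equiv.Perm V) {i : ℕ} (hi : Even i)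
    (hin : i ≤ Fintype.card V) :
    (∏ v, Matrix.charmatrix (adjMat ℝ G) (σ v) v).coeff (Fintype.card V - i) =
      if MovesAlong G σ ∧ σ.support.card = i then 1 else 0 := by
  rw [prod_charmatrix_adjMat]
  have hle : σ.support.card ≤ Fintype.card V := Finset.card_le_univ _
  by_cases h : MovesAlong G σ
  · by_cases hc : σ.support.card = i
    · simp [h, hc, hi.neg_one_pow]
    · rw [if_pos h, if_neg (by simp [hc]), coeff_C_mul, coeff_X_pow, if_neg (by omega), mul_zero]
  · simp [h]

theorem coeff_permPolyG (G : SimpleGraph V) {i : ℕ} (hi : Even i) (hin : i ≤ Fintype.card V) :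
    (permPolyG ℝ G).coeff (Fintype.card V - i) =
      ∑ σ : Equiv.Perm V, if MovesAlong G σ ∧ σ.support.card = i then (1 : ℝ) else 0 := by
  rw [permPolyG, Matrix.permanent, finsetSum_coeff]
  exact Finset.sum_congr rfl fun σ _ => coeff_prod_charmatrix_adjMat G σ hi hin

theorem coeff_charPolyG (G : SimpleGraph V) {i : ℕ} (hi : Even i) (hin : i ≤ Fintype.card V) :
    (charPolyG ℝ G).coeff (Fintype.card V - i) =
      ∑ σ : Equiv.Perm V, if MovesAlong G σ ∧ σ.support.card = i then
        ((Equiv.Perm.sign σ : ℤ) : ℝ) else 0 := by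
  rw [charPolyG, Matrix.charpoly, Matrix.det_apply, finsetSum_coeff]
  refine Finset.sum_congr rfl fun σ _ => ?_
  rw [Units.smul_def, coeff_smul, coeff_prod_charmatrix_adjMat G σ hi hin, zsmul_eq_mul]
  split_ifs <;> simp

end Coefficients

variable {G : SimpleGraph V} {σ τ : Equiv.Perm V} {H : G.Subgraph}

theorem Traces.coe_adj (h : Traces σ H) {x y : H.verts} :
    H.coe.Adj x y ↔ σ x = y ∨ σ y = x := by
  rw [Subgraph.coe_adj, h.2, and_iff_right_iff_imp]
  rintro (hxy | hyx) heq
  · exact (h.1 x).1 x.2 (hxy.trans heq.symm)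
  · exact (h.1 y).1 y.2 (hyx.trans heq)

theorem Traces.apply_mem (h : Traces σ H) {v : V} (hv : v ∈ H.verts) : σ v ∈ H.verts :=
  (h.1 _).2 fun hσ => (h.1 v).1 hv (σ.injective hσ)

theorem Traces.inv_apply_mem (h : Traces σ H) {v : V} (hv : v ∈ H.verts) : σ⁻¹ v ∈ H.verts := by
  refine (h.1 _).2 fun hσ => (h.1 v).1 hv ?_
  simpa using Equiv.Perm.eq_inv_iff_eq.1 hσ

theorem Traces.inv (h : Traces σ H) : Traces σ⁻¹ H := by
  refine ⟨fun v => ?_, fun u v => ?_⟩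
  · rw [h.1, not_iff_not, Equiv.Perm.inv_eq_iff_eq, eq_comm]
  · rw [h.2, Equiv.Perm.inv_eq_iff_eq, Equiv.Perm.inv_eq_iff_eq, eq_comm (a := u) (b := σ v),
      eq_comm (a := v) (b := σ u), or_comm]

theorem Equiv.Perm.SameCycle.apply_apply_eq_self {x y : V} (h : σ.SameCycle x y)
    (hx : σ (σ x) = x) : σ (σ y) = y := by
  obtain ⟨n, rfl⟩ := h
  have hcomm : σ * σ * σ ^ n = σ ^ n * (σ * σ) :=
    ((Commute.refl σ).mul_left (Commute.refl σ)).zpow_right n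
  simpa [hx] using congrArg (fun ρ : Equiv.Perm V => ρ x) hcomm

theorem Traces.neighborSet_coe (h : Traces σ H) (x : H.verts) :
    H.coe.neighborSet x = {⟨σ x, h.apply_mem x.2⟩, ⟨σ⁻¹ x, h.inv_apply_mem x.2⟩} := by
  ext y
  rw [mem_neighborSet, h.coe_adj, Set.mem_insert_iff, Set.mem_singleton_iff, Subtype.ext_iff,
    Subtype.ext_iff, Equiv.Perm.eq_inv_iff_eq, eq_comm (a := σ x)]

theorem Traces.ncard_neighborSet_coe (h : Traces σ H) {x : H.verts} (hx : σ (σ x) ≠ x) :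
    (H.coe.neighborSet x).ncard = 2 := by
  rw [h.neighborSet_coe, Set.ncard_pair]
  intro heq
  exact hx (Equiv.Perm.eq_inv_iff_eq.1 (Subtype.ext_iff.1 heq))

theorem IsEdgeComp.exists_perm {c : H.coe.ConnectedComponent} (hc : IsEdgeComp H c) :
    ∃ p : Equiv.Perm H.verts, ∀ a ∈ c.supp,
      H.coe.Adj a (p a) ∧ ∀ b, H.coe.Adj a b → p a = b ∨ p b = a := by
  obtain ⟨x, y, hxy, hsupp⟩ := hc
  refine ⟨Equiv.swap x y, fun a ha => ?_⟩
  have hb : ∀ b, H.coe.Adj a b → b ∈ c.supp := fun b hab => by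
    rw [ConnectedComponent.mem_supp_iff] at ha ⊢
    rw [← ha]
    exact (ConnectedComponent.connectedComponentMk_eq_of_adj hab).symm
  rw [hsupp] at ha hb
  rcases ha with rfl | rfl
  · rw [Equiv.swap_apply_left]
    refine ⟨hxy, fun b hab => ?_⟩
    rcases hb b hab with rfl | rfl
    · exact (hab.ne rfl).elim
    · exact Or.inl rfl
  · rw [Equiv.swap_apply_right]
    refine ⟨hxy.symm, fun b hab => ?_⟩
    rcases hb b hab with rfl | rfl
    · exact Or.inl rfl
    · exact (hab.ne rfl).elim

theorem IsCycleComp.exists_perm {c : H.coe.ConnectedComponent} (hc : IsCycleComp H c) :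
    ∃ p : Equiv.Perm H.verts, ∀ a ∈ c.supp,
      H.coe.Adj a (p a) ∧ ∀ b, H.coe.Adj a b → p a = b ∨ p b = a := by
  obtain ⟨v, w, hw, hsupp, hadj⟩ := hc
  have hlen : w.support.tail.length = w.length := by simp
  have hpos : 0 < w.length := by have := hw.three_le_length; omega
  have hget : ∀ i (hi : i < w.support.tail.length), w.support.tail[i] = w.getVert (i + 1) := by
    intro i hi
    rw [List.getElem_tail, Walk.support_getElem_eq_getVert]
  have hstep : ∀ i < w.length, w.support.tail.formPerm (w.getVert i) = w.getVert (i + 1) := by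
    have hsucc : ∀ i, i < w.length → w.support.tail.formPerm (w.getVert (i + 1)) =
        w.getVert ((i + 1) % w.length + 1) := by
      intro i hi
      rw [← hget i (by omega), List.formPerm_apply_getElem _ hw.support_nodup, hget]
      simp only [hlen]
    intro i hi
    rcases i with _ | i
    · have := hsucc (w.length - 1) (by omega)
      rw [Nat.sub_add_cancel hpos, Nat.mod_self] at this
      rw [← this]
      simp
    · rw [hsucc i (by omega), Nat.mod_eq_of_lt hi]
  refine ⟨w.support.tail.formPerm, fun a ha => ⟨?_, fun b hab => ?_⟩⟩
  · have ha' : a ∈ w.support := by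
      rw [← hsupp] at ha
      exact ha
    obtain ⟨i, rfl, hi⟩ := Walk.mem_support_iff_exists_getVert.1 ha'
    rcases hi.lt_or_eq with hi | rfl
    · rw [hstep i hi]
      exact w.adj_getVert_succ hi
    · have h0 : w.getVert w.length = w.getVert 0 := by simp
      rw [h0, hstep 0 hpos]
      exact w.adj_getVert_succ hpos
  · obtain ⟨i, hi, hlt⟩ := (w.toSubgraph_adj_iff).1 (hadj a b hab ha)
    rcases Sym2.eq_iff.1 hi with ⟨rfl, rfl⟩ | ⟨rfl, rfl⟩
    · exact Or.inl (hstep i hlt)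
    · exact Or.inr (hstep i hlt)

/-- The permutation agreeing with `σ` on the `σ`-invariant set `P` and with `σ⁻¹` elsewhere. -/
def partialInverse (σ : Equiv.Perm V) (P : V → Prop) (hP : ∀ v, P (σ v) ↔ P v) :
    Equiv.Perm V where
  toFun v := if P v then σ v else σ⁻¹ v
  invFun v := if P v then σ⁻¹ v else σ v
  left_inv v := by
    have h := hP (σ⁻¹ v)
    simp only [Equiv.Perm.coe_inv, Equiv.apply_symm_apply] at h ⊢
    by_cases hv : P v <;> simp [hv, hP, ← h]
  right_inv v := by
    have h := hP (σ⁻¹ v)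
    simp only [Equiv.Perm.coe_inv, Equiv.apply_symm_apply] at h ⊢
    by_cases hv : P v <;> simp [hv, hP, ← h]

theorem partialInverse_apply (σ : Equiv.Perm V) (P : V → Prop) (hP : ∀ v, P (σ v) ↔ P v) (v : V) :
    partialInverse σ P hP v = if P v then σ v else σ⁻¹ v := rfl

theorem Traces.traces_partialInverse (h : Traces σ H) {P : V → Prop} (hP : ∀ v, P (σ v) ↔ P v) :
    Traces (partialInverse σ P hP) H := by
  have hP' : ∀ v, P (σ⁻¹ v) ↔ P v := fun v => by
    rw [← hP (σ⁻¹ v)]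
    simp
  refine ⟨fun v => ?_, fun u v => ?_⟩
  · rw [partialInverse_apply]
    split_ifs
    · exact h.1 v
    · exact h.inv.1 v
  · rw [partialInverse_apply, partialInverse_apply]
    by_cases hu : P u <;> by_cases hv : P v
    · simpa only [hu, hv, if_true] using h.2 u v
    · have hn : ¬ H.Adj u v := by
        rw [h.2]
        rintro ⟨-, rfl | rfl⟩
        · exact hv ((hP u).2 hu)
        · exact hv ((hP v).1 hu)
      simp only [hu, hv, if_true, if_false, hn, false_iff]
      rintro ⟨-, rfl | rfl⟩
      · exact hv ((hP u).2 hu)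
      · exact hv ((hP' v).1 hu)
    · have hn : ¬ H.Adj u v := by
        rw [h.2]
        rintro ⟨-, rfl | rfl⟩
        · exact hu ((hP u).1 hv)
        · exact hu ((hP v).2 hv)
      simp only [hu, hv, if_true, if_false, hn, false_iff]
      rintro ⟨-, rfl | rfl⟩
      · exact hu ((hP' u).1 hv)
      · exact hu ((hP v).2 hv)
    · simpa only [hu, hv, if_false] using h.inv.2 u v

theorem Traces.apply_eq_or_eq_inv (hσ : Traces σ H) (hτ : Traces τ H) (v : V) :
    τ v = σ v ∨ τ v = σ⁻¹ v := by
  by_cases hv : τ v = v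
  · left
    have : v ∉ H.verts := fun hv' => (hτ.1 v).1 hv' hv
    rw [hv, not_not.1 (mt (hσ.1 v).2 this)]
  · have := (hσ.2 v (τ v)).1 ((hτ.2 v (τ v)).2 ⟨Ne.symm hv, Or.inl rfl⟩)
    rw [Equiv.Perm.eq_inv_iff_eq]
    exact this.2.imp Eq.symm id

variable [Finite V]

theorem Traces.reachable_iff (h : Traces σ H) {x y : H.verts} :
    H.coe.Reachable x y ↔ σ.SameCycle x y := by
  constructor
  · rintro ⟨p⟩
    induction p with
    | nil => exact Equiv.Perm.SameCycle.refl _ _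
    | cons hadj _ ih =>
      refine Equiv.Perm.SameCycle.trans ?_ ih
      rcases h.coe_adj.1 hadj with hσ | hσ
      · rw [← hσ]
        exact (Equiv.Perm.SameCycle.refl _ _).apply_right
      · rw [← hσ]
        exact (Equiv.Perm.SameCycle.refl _ _).apply_left
  · intro hxy
    obtain ⟨n, hn⟩ := hxy.exists_nat_pow_eq
    induction n generalizing y with
    | zero =>
      rw [Subtype.ext (hn : (x : V) = y)]
    | succ n ih =>
      rw [pow_succ', Equiv.Perm.mul_apply] at hn
      have hmem : (σ ^ n) x ∈ H.verts := by
        rw [← Equiv.Perm.inv_eq_iff_eq.2 hn.symm]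
        exact h.inv_apply_mem y.2
      refine (ih (y := ⟨_, hmem⟩) ⟨n, rfl⟩ rfl).trans (Adj.reachable ?_)
      exact h.coe_adj.2 (Or.inl hn)

theorem Traces.mem_supp_iff (h : Traces σ H) {c : H.coe.ConnectedComponent} {x y : H.verts}
    (hx : x ∈ c.supp) : y ∈ c.supp ↔ σ.SameCycle x y := by
  rw [ConnectedComponent.mem_supp_iff] at hx
  subst hx
  rw [ConnectedComponent.mem_supp_iff, ConnectedComponent.eq, h.reachable_iff,
    Equiv.Perm.sameCycle_comm]

theorem IsCycleComp.apply_apply_ne (h : Traces σ H) {c : H.coe.ConnectedComponent}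
    (hc : IsCycleComp H c) {x : H.verts} (hx : x ∈ c.supp) : σ (σ x) ≠ x := by
  obtain ⟨v, w, hw, hsupp, -⟩ := hc
  intro hσ
  have hcard := hw.ncard_neighborSet_toSubgraph_eq_two (v := x) (by
    rw [← hsupp] at hx; exact hx)
  have hsub : w.toSubgraph.neighborSet x ⊆ {⟨σ x, h.apply_mem x.2⟩} := by
    intro y hy
    rcases h.coe_adj.1 (w.toSubgraph.adj_sub hy) with hy | hy
    · exact Subtype.ext hy.symm
    · exact Subtype.ext (σ.injective (hy.trans hσ.symm))
  have := Set.ncard_le_ncard hsub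
  rw [hcard, Set.ncard_singleton] at this
  omega

theorem Traces.isEdgeComp (h : Traces σ H) {c : H.coe.ConnectedComponent} {x : H.verts}
    (hx : x ∈ c.supp) (hσ : σ (σ x) = x) : IsEdgeComp H c := by
  refine ⟨x, ⟨σ x, h.apply_mem x.2⟩, h.coe_adj.2 (Or.inl rfl), ?_⟩
  ext y
  rw [h.mem_supp_iff hx]
  constructor
  · intro hxy
    obtain ⟨n, hn⟩ := hxy.exists_nat_pow_eq
    have key : ∀ n : ℕ, (σ ^ n) x = x ∨ (σ ^ n) x = σ x := by
      intro n
      induction n with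
      | zero => exact Or.inl rfl
      | succ n ih =>
        rw [pow_succ', Equiv.Perm.mul_apply]
        rcases ih with ih | ih <;> rw [ih] <;> simp [hσ]
    rcases key n with hk | hk
    · exact Or.inl (Subtype.ext (hn.symm.trans hk))
    · exact Or.inr (Subtype.ext (hn.symm.trans hk))
  · rintro (rfl | rfl)
    · exact Equiv.Perm.SameCycle.refl _ _
    · exact (Equiv.Perm.SameCycle.refl _ _).apply_right

theorem Traces.isCycleComp (h : Traces σ H) {c : H.coe.ConnectedComponent} {x : H.verts}
    (hx : x ∈ c.supp) (hσ : σ (σ x) ≠ x) : IsCycleComp H c := by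
  have hdeg : ∀ y ∈ c.supp, (H.coe.neighborSet y).ncard = 2 := fun y hy =>
    h.ncard_neighborSet_coe fun hy' =>
      hσ (((h.mem_supp_iff hx).1 hy).symm.apply_apply_eq_self hy')
  let K : SimpleGraph H.verts :=
    { Adj := fun y z => H.coe.Adj y z ∧ y ∈ c.supp
      symm := ⟨fun y z hyz => ⟨hyz.1.symm, by
        have := hyz.2
        rw [ConnectedComponent.mem_supp_iff] at this ⊢
        rw [← this]
        exact (ConnectedComponent.connectedComponentMk_eq_of_adj hyz.1).symm⟩⟩
      loopless := ⟨fun y hy => hy.1.ne rfl⟩ }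
  have hKH : K ≤ H.coe := fun y z hyz => hyz.1
  have hnbr : ∀ y ∈ c.supp, K.neighborSet y = H.coe.neighborSet y := fun y hy => by
    ext z
    exact ⟨fun hz => hz.1, fun hz => ⟨hz, hy⟩⟩
  have hK : K.IsCycles := by
    rintro y ⟨z, hz⟩
    rw [hnbr y hz.2]
    exact hdeg y hz.2
  have hsupp : (K.connectedComponentMk x).supp = c.supp := by
    ext y
    rw [ConnectedComponent.mem_supp_iff, ConnectedComponent.eq]
    constructor
    · intro hyx
      rw [ConnectedComponent.mem_supp_iff] at hx ⊢
      rw [← hx]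
      exact ConnectedComponent.eq.2 (hyx.mono hKH)
    · intro hy
      have hr : H.coe.Reachable y x := by
        rw [ConnectedComponent.mem_supp_iff] at hx hy
        exact ConnectedComponent.eq.1 (hy.trans hx.symm)
      obtain ⟨p⟩ := hr
      clear hσ
      induction p with
      | nil => exact Reachable.refl _
      | cons hadj _ ih =>
        have hK' : K.Adj _ _ := ⟨hadj, hy⟩
        exact hK'.reachable.trans (ih hx hK'.symm.2)
  have hne : (K.neighborSet x).Nonempty := by
    rw [hnbr x hx]
    exact Set.nonempty_of_ncard_ne_zero (by rw [hdeg x hx]; decide)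
  obtain ⟨w, hw, hverts⟩ :=
    hK.exists_cycle_toSubgraph_verts_eq_connectedComponentSupp
      (ConnectedComponent.mem_supp_iff _ _ |>.2 rfl) hne
  have hw' : (w.mapLe hKH).IsCycle := hw.mapLe hKH
  have hsupp' : {y | y ∈ (w.mapLe hKH).support} = c.supp := by
    rw [← hsupp, ← hverts, Walk.verts_toSubgraph, Walk.support_mapLe_eq_support]
  refine ⟨x, w.mapLe hKH, hw', hsupp', fun y z hyz hy => ?_⟩
  have heq : (w.mapLe hKH).toSubgraph.neighborSet y = H.coe.neighborSet y := by
    refine Set.eq_of_subset_of_ncard_le (fun z hz => (Subgraph.adj_sub _ hz)) ?_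
    rw [hdeg y hy, hw'.ncard_neighborSet_toSubgraph_eq_two]
    rw [← hsupp'] at hy
    exact hy
  have : z ∈ H.coe.neighborSet y := hyz
  rw [← heq] at this
  exact this

theorem Traces.isCycleComp_iff (h : Traces σ H) {c : H.coe.ConnectedComponent} {x : H.verts}
    (hx : x ∈ c.supp) : IsCycleComp H c ↔ σ (σ x) ≠ x :=
  ⟨fun hc => hc.apply_apply_ne h hx, h.isCycleComp hx⟩

theorem Traces.isSachs (h : Traces σ H) : IsSachs H := by
  intro c
  obtain ⟨x, hx⟩ := c.nonempty_supp
  by_cases hσ : σ (σ x) = x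
  · exact Or.inl (h.isEdgeComp hx hσ)
  · exact Or.inr (h.isCycleComp hx hσ)

theorem IsSachs.exists_traces (hH : IsSachs H) : ∃ σ : Equiv.Perm V, Traces σ H := by
  have hex : ∀ c : H.coe.ConnectedComponent, ∃ p : Equiv.Perm H.verts, ∀ a ∈ c.supp,
      H.coe.Adj a (p a) ∧ ∀ b, H.coe.Adj a b → p a = b ∨ p b = a := fun c =>
    (hH c).elim IsEdgeComp.exists_perm IsCycleComp.exists_perm
  choose P hP using hex
  let f : H.verts → H.verts := fun x => P (H.coe.connectedComponentMk x) x
  have hadj : ∀ x, H.coe.Adj x (f x) := fun x => (hP _ x rfl).1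
  have hcomp : ∀ {x y}, H.coe.Adj x y →
      H.coe.connectedComponentMk x = H.coe.connectedComponentMk y :=
    fun hxy => ConnectedComponent.connectedComponentMk_eq_of_adj hxy
  have hf : ∀ x y, H.coe.Adj x y → f x = y ∨ f y = x := by
    intro x y hxy
    have := (hP _ x rfl).2 y hxy
    simp only [f]
    rwa [← hcomp hxy]
  have hinj : Function.Injective f := by
    intro x y hxy
    have hc : H.coe.connectedComponentMk x = H.coe.connectedComponentMk y := by
      rw [hcomp (hadj x), hxy, ← hcomp (hadj y)]
    simp only [f, hc] at hxy
    exact (P _).injective hxy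
  let p : Equiv.Perm H.verts := Equiv.ofBijective f (Finite.injective_iff_bijective.1 hinj)
  have hp : ∀ x, p x = f x := fun _ => rfl
  have hmem : ∀ (v : V) (hv : v ∈ H.verts), Equiv.Perm.ofSubtype p v = f ⟨v, hv⟩ := fun v hv => by
    rw [Equiv.Perm.ofSubtype_apply_of_mem p hv, hp]
  have hnot : ∀ v ∉ H.verts, Equiv.Perm.ofSubtype p v = v := fun v hv =>
    Equiv.Perm.ofSubtype_apply_of_not_mem p hv
  have hmoved : ∀ v, Equiv.Perm.ofSubtype p v ≠ v → H.Adj v (Equiv.Perm.ofSubtype p v) := by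
    intro v hv
    have hvH : v ∈ H.verts := by
      by_contra hvH
      exact hv (hnot v hvH)
    rw [hmem v hvH]
    exact hadj ⟨v, hvH⟩
  refine ⟨Equiv.Perm.ofSubtype p, fun v => ⟨fun hv => ?_, fun hv => H.edge_vert (hmoved v hv)⟩,
    fun u v => ⟨fun huv => ⟨huv.ne, ?_⟩, ?_⟩⟩
  · rw [hmem v hv]
    exact fun h => (hadj ⟨v, hv⟩).ne (Subtype.ext h.symm)
  · rw [hmem u (H.edge_vert huv), hmem v (H.edge_vert huv.symm)]
    exact (hf ⟨u, H.edge_vert huv⟩ ⟨v, H.edge_vert huv.symm⟩ huv).imp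
      (congrArg Subtype.val) (congrArg Subtype.val)
  · rintro ⟨hne, rfl | rfl⟩
    · exact hmoved u hne.symm
    · exact (hmoved v hne).symm

theorem Traces.apply_eq_of_sameCycle (hσ : Traces σ H) (hτ : Traces τ H) {x y : V}
    (hxy : σ.SameCycle x y) (hx : τ x = σ x) : τ y = σ y := by
  obtain ⟨n, rfl⟩ := hxy.exists_nat_pow_eq
  clear hxy
  induction n with
  | zero => exact hx
  | succ n ih =>
    rw [pow_succ', Equiv.Perm.mul_apply]
    generalize (σ ^ n) x = v at ih
    rcases hσ.apply_eq_or_eq_inv hτ (σ v) with h | h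
    · exact h
    · rcases hτ.apply_eq_or_eq_inv hσ (σ v) with h' | h'
      · exact h'.symm
      · rw [h, h', Equiv.Perm.eq_inv_iff_eq]
        simpa using ih

theorem Traces.card_traces (hσ : Traces σ H) :
    Nat.card {τ : Equiv.Perm V // Traces τ H} = 2 ^ cycCount H := by
  let F : {τ : Equiv.Perm V // Traces τ H} → Set {c : H.coe.ConnectedComponent | IsCycleComp H c} :=
    fun τ => {c | ∃ x ∈ c.1.supp, τ.1 x = σ x}
  have hF : Function.Bijective F := by
    constructor
    · rintro ⟨τ, hτ⟩ ⟨τ', hτ'⟩ heq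
      refine Subtype.ext (Equiv.ext fun v => ?_)
      by_cases hv : v ∈ H.verts
      swap
      · rw [not_not.1 (mt (hτ.1 v).2 hv), not_not.1 (mt (hτ'.1 v).2 hv)]
      have hvc : (⟨v, hv⟩ : H.verts) ∈ (H.coe.connectedComponentMk ⟨v, hv⟩).supp := rfl
      by_cases hc : IsCycleComp H (H.coe.connectedComponentMk ⟨v, hv⟩)
      · have hkey : ∀ {ρ : Equiv.Perm V} (hρ : Traces ρ H),
            ⟨_, hc⟩ ∈ F ⟨ρ, hρ⟩ ↔ ρ v = σ v := by
          intro ρ hρ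
          constructor
          · rintro ⟨x, hx, hρx⟩
            exact hσ.apply_eq_of_sameCycle hρ ((hσ.mem_supp_iff hx).1 hvc) hρx
          · exact fun h => ⟨_, hvc, h⟩
        have hiff : τ v = σ v ↔ τ' v = σ v := by
          rw [← hkey hτ, ← hkey hτ', heq]
        rcases hσ.apply_eq_or_eq_inv hτ v with h | h
        · exact h.trans (hiff.1 h).symm
        · rcases hσ.apply_eq_or_eq_inv hτ' v with h' | h'
          · exact (hiff.2 h').trans h'.symm
          · exact h.trans h'.symm
      · have hvv : σ v = σ⁻¹ v := by
          rw [Equiv.Perm.eq_inv_iff_eq]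
          exact not_not.1 (mt (hσ.isCycleComp_iff hvc).2 hc)
        have h := hσ.apply_eq_or_eq_inv hτ v
        have h' := hσ.apply_eq_or_eq_inv hτ' v
        rw [← hvv, or_self] at h h'
        exact h.trans h'.symm
    · intro S
      let P : V → Prop := fun v => ∃ hv : v ∈ H.verts,
        ∃ hc : IsCycleComp H (H.coe.connectedComponentMk ⟨v, hv⟩), ⟨_, hc⟩ ∈ S
      have hPmk : ∀ (x : H.verts) (c : {c : H.coe.ConnectedComponent | IsCycleComp H c}),
          x ∈ c.1.supp → (P x ↔ c ∈ S) := by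
        rintro x ⟨c, hc⟩ hx
        rw [ConnectedComponent.mem_supp_iff] at hx
        subst hx
        exact ⟨fun ⟨_, _, h⟩ => h, fun h => ⟨x.2, hc, h⟩⟩
      have hP : ∀ v, P (σ v) ↔ P v := by
        intro v
        by_cases hv : v ∈ H.verts
        · have hmk : H.coe.connectedComponentMk ⟨σ v, hσ.apply_mem hv⟩ =
              H.coe.connectedComponentMk ⟨v, hv⟩ :=
            ConnectedComponent.connectedComponentMk_eq_of_adj (hσ.coe_adj.2 (Or.inr rfl))
          constructor
          · rintro ⟨_, hc, hS⟩
            exact (hPmk ⟨v, hv⟩ ⟨_, hc⟩ hmk.symm).2 hS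
          · rintro ⟨_, hc, hS⟩
            exact (hPmk ⟨σ v, hσ.apply_mem hv⟩ ⟨_, hc⟩ hmk).2 hS
        · rw [not_not.1 (mt (hσ.1 v).2 hv)]
      refine ⟨⟨partialInverse σ P hP, hσ.traces_partialInverse hP⟩, ?_⟩
      ext c
      constructor
      · rintro ⟨x, hx, hxσ⟩
        by_contra hc
        rw [partialInverse_apply, if_neg (mt (hPmk x c hx).1 hc), eq_comm,
          Equiv.Perm.eq_inv_iff_eq] at hxσ
        exact c.2.apply_apply_ne hσ hx hxσ
      · intro hc
        obtain ⟨x, hx⟩ := c.1.nonempty_supp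
        refine ⟨x, hx, ?_⟩
        rw [partialInverse_apply, if_pos ((hPmk x c hx).2 hc)]
  have : Fintype {c : H.coe.ConnectedComponent | IsCycleComp H c} := Fintype.ofFinite _
  rw [Nat.card_congr (Equiv.ofBijective F hF), Nat.card_eq_fintype_card, Fintype.card_set, cycCount,
    ← Nat.card_coe_set_eq, Nat.card_eq_fintype_card]

theorem Traces.ncard_supp_eq_two (h : Traces σ H) {c : H.coe.ConnectedComponent}
    (hc : ¬ IsCycleComp H c) : c.supp.ncard = 2 := by
  obtain ⟨x, hx⟩ := c.nonempty_supp
  obtain ⟨y, z, hyz, hsupp⟩ := h.isEdgeComp hx (not_not.1 (mt (h.isCycleComp_iff hx).2 hc))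
  rw [hsupp, Set.ncard_pair hyz.ne]

end Permutations

section Counting

variable {V : Type*} [Fintype V] {G : SimpleGraph V} {σ : Equiv.Perm V} {H : G.Subgraph}

theorem Traces.card_support (h : Traces σ H) : σ.support.card = H.verts.ncard := by
  rw [← Set.ncard_coe_finset]
  congr 1
  ext v
  simp [h.1]

theorem Traces.ncard_supp (h : Traces σ H) {c : H.coe.ConnectedComponent} {x : H.verts}
    (hx : x ∈ c.supp) : c.supp.ncard = (σ.cycleOf x).support.card := by
  rw [← Set.ncard_coe_finset, ← Set.ncard_image_of_injective _ Subtype.val_injective]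
  congr 1
  ext v
  rw [Set.mem_image, Finset.mem_coe, Equiv.Perm.mem_support_cycleOf_iff]
  constructor
  · rintro ⟨y, hy, rfl⟩
    exact ⟨(h.mem_supp_iff hx).1 hy, Equiv.Perm.mem_support.2 ((h.1 x).1 x.2)⟩
  · rintro ⟨hv, -⟩
    have hvH : v ∈ H.verts :=
      (h.1 v).2 fun hσ => (h.1 x).1 x.2 (hv.apply_eq_self_iff.2 hσ)
    exact ⟨⟨v, hvH⟩, (h.mem_supp_iff hx).2 hv, rfl⟩

theorem MovesAlong.even_card_cycleOf (hG : G.Colorable 2) (h : MovesAlong G σ) {v : V}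
    (hv : σ v ≠ v) : Even (σ.cycleOf v).support.card := by
  obtain ⟨col⟩ := hG
  have hstep : ∀ n : ℕ, (col ((σ ^ n) v) = col v ↔ Even n) := by
    intro n
    induction n with
    | zero => simp
    | succ n ih =>
      have hne : (σ ^ (n + 1)) v ≠ (σ ^ n) v := by
        rw [pow_succ, Equiv.Perm.mul_apply]
        exact fun heq => hv ((σ ^ n).injective heq)
      rw [pow_succ', Equiv.Perm.mul_apply] at hne ⊢
      have hcol := col.valid (h _ hne)
      rw [Nat.even_add_one, ← ih]
      generalize col (σ ((σ ^ n) v)) = a at *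
      generalize col ((σ ^ n) v) = b at *
      generalize col v = c at *
      clear ih
      omega
  rw [← hstep, ← Equiv.Perm.pow_mod_card_support_cycleOf_self_apply]
  simp

theorem Traces.even_ncard_supp (hG : G.Colorable 2) (h : Traces σ H)
    (c : H.coe.ConnectedComponent) : Even c.supp.ncard := by
  obtain ⟨x, hx⟩ := c.nonempty_supp
  rw [h.ncard_supp hx]
  exact h.movesAlong.even_card_cycleOf hG ((h.1 x).1 x.2)

theorem Traces.cycCount_eq (hG : G.Colorable 2) (h : Traces σ H) :
    cycCount H = sCount H + tCount H := by
  rw [cycCount, sCount, tCount, ← Set.ncard_union_eq]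
  · congr 1
    ext c
    have := Nat.even_iff.1 (h.even_ncard_supp hG c)
    simp only [Set.mem_ofPred_eq, Set.mem_union, ← and_or_left, iff_self_and]
    omega
  · rw [Set.disjoint_left]
    rintro c ⟨-, h0⟩ ⟨-, h2⟩
    omega

theorem Traces.card_cycleFactorsFinset_filter (h : Traces σ H) :
    (σ.cycleFactorsFinset.filter fun f => f.support.card % 4 = 0).card = sCount H := by
  rw [sCount, ← Set.ncard_coe_finset, eq_comm]
  refine Set.ncard_congr (fun c _ => σ.cycleOf c.nonempty_supp.some) ?_ ?_ ?_
  · rintro c ⟨-, hc⟩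
    have hx := c.nonempty_supp.some_mem
    rw [Finset.mem_coe, Finset.mem_filter, Equiv.Perm.cycleOf_mem_cycleFactorsFinset_iff,
      Equiv.Perm.mem_support, ← h.ncard_supp hx]
    exact ⟨(h.1 _).1 (Subtype.prop _), hc⟩
  · intro c d _ _ hcd
    have hx := c.nonempty_supp.some_mem
    have hy := d.nonempty_supp.some_mem
    have hxy := (Equiv.Perm.sameCycle_iff_cycleOf_eq_of_mem_support
      (Equiv.Perm.mem_support.2 ((h.1 _).1 (Subtype.prop _)))
      (Equiv.Perm.mem_support.2 ((h.1 _).1 (Subtype.prop _)))).2 hcd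
    exact ConnectedComponent.eq_of_common_vertex ((h.mem_supp_iff hx).2 hxy) hy
  · intro f hf
    rw [Finset.mem_coe, Finset.mem_filter] at hf
    obtain ⟨hf, hcard⟩ := hf
    obtain ⟨v, hv⟩ := (Equiv.Perm.mem_cycleFactorsFinset_iff.1 hf).1.nonempty_support
    have hfv := Equiv.Perm.cycle_is_cycleOf hv hf
    have hvH : v ∈ H.verts := by
      rw [h.1, ← Equiv.Perm.mem_support]
      exact Equiv.Perm.mem_cycleFactorsFinset_support_le hf hv
    set c := H.coe.connectedComponentMk ⟨v, hvH⟩ with hc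
    have hvc : (⟨v, hvH⟩ : H.verts) ∈ c.supp := rfl
    have hcard' : c.supp.ncard % 4 = 0 := by
      rw [h.ncard_supp hvc, ← hfv, hcard]
    refine ⟨c, ⟨?_, hcard'⟩, ?_⟩
    · by_contra hcyc
      rw [h.ncard_supp_eq_two hcyc] at hcard'
      omega
    · rw [hfv]
      exact ((h.mem_supp_iff hvc).1 c.nonempty_supp.some_mem).cycleOf_eq.symm

theorem Traces.neg_one_pow_mul_sign (hG : G.Colorable 2) (h : Traces σ H) :
    (-1 : ℤˣ) ^ (σ.support.card / 2) * Equiv.Perm.sign σ = (-1) ^ sCount H := by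
  have heven : ∀ f ∈ σ.cycleFactorsFinset, Even f.support.card := by
    intro f hf
    obtain ⟨v, hv⟩ := (Equiv.Perm.mem_cycleFactorsFinset_iff.1 hf).1.nonempty_support
    rw [Equiv.Perm.cycle_is_cycleOf hv hf]
    exact h.movesAlong.even_card_cycleOf hG
      (Equiv.Perm.mem_support.1 (Equiv.Perm.mem_cycleFactorsFinset_support_le hf hv))
  have hhalf : σ.support.card / 2 = ∑ f ∈ σ.cycleFactorsFinset, f.support.card / 2 := by
    have hsum : σ.support.card = ∑ f ∈ σ.cycleFactorsFinset, f.support.card := by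
      rw [← Equiv.Perm.sum_cycleType, Equiv.Perm.cycleType_def]
      rfl
    rw [hsum, Finset.sum_congr rfl fun f hf => (Nat.two_mul_div_two_of_even (heven f hf)).symm,
      ← Finset.mul_sum, Nat.mul_div_cancel_left _ two_pos]
  have hsign : Equiv.Perm.sign σ = ∏ f ∈ σ.cycleFactorsFinset, -(-1 : ℤˣ) ^ f.support.card := by
    rw [Equiv.Perm.sign_of_cycleType', Equiv.Perm.cycleType_def, Multiset.map_map]
    rfl
  rw [hhalf, hsign, ← Finset.prod_pow_eq_pow_sum, ← Finset.prod_mul_distrib,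
    ← h.card_cycleFactorsFinset_filter, ← Finset.prod_const, Finset.prod_filter]
  refine Finset.prod_congr rfl fun f hf => ?_
  rw [(heven f hf).neg_one_pow, mul_neg_one]
  have := Nat.even_iff.1 (heven f hf)
  split_ifs with h4
  · rw [Even.neg_one_pow (Nat.even_iff.2 (by omega))]
  · rw [Odd.neg_one_pow (Nat.odd_iff.2 (by omega)), neg_neg]

theorem coeff_permPolyG_sub_coeff_charPolyG (G : SimpleGraph V) (hG : G.Colorable 2) {i : ℕ}
    (hi : Even i) (hin : i ≤ Fintype.card V) :
    (permPolyG ℝ G).coeff (Fintype.card V - i)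
        - (-1 : ℝ) ^ (i / 2) * (charPolyG ℝ G).coeff (Fintype.card V - i) =
      ∑ σ : Equiv.Perm V with MovesAlong G σ ∧ σ.support.card = i,
        (1 - (-1 : ℝ) ^ sCount (tracedSubgraph G σ)) := by
  rw [coeff_permPolyG G hi hin, coeff_charPolyG G hi hin, Finset.mul_sum, ← Finset.sum_sub_distrib,
    Finset.sum_filter]
  refine Finset.sum_congr rfl fun σ _ => ?_
  split_ifs with h
  · have hs := congrArg (fun u : ℤˣ => ((u : ℤ) : ℝ)) (h.1.traces.neg_one_pow_mul_sign hG)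
    rw [h.2] at hs
    push_cast at hs
    rw [hs]
  · simp

theorem sum_movesAlong_eq_sum_isSachs (G : SimpleGraph V) (hG : G.Colorable 2) (i : ℕ) :
    ∑ σ : Equiv.Perm V with MovesAlong G σ ∧ σ.support.card = i,
        (1 - (-1 : ℝ) ^ sCount (tracedSubgraph G σ)) =
      ∑ H : G.Subgraph with IsSachs H ∧ H.verts.ncard = i,
        2 ^ (sCount H + tCount H) * (1 - (-1 : ℝ) ^ sCount H) := by
  rw [← Finset.sum_fiberwise_of_maps_to (g := tracedSubgraph G)
    (t := {H : G.Subgraph | IsSachs H ∧ H.verts.ncard = i})]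
  · refine Finset.sum_congr rfl fun H hH => ?_
    obtain ⟨-, hSachs, hcard⟩ := Finset.mem_filter.1 hH
    obtain ⟨σ, hσ⟩ := hSachs.exists_traces
    rw [← hσ.cycCount_eq hG]
    have hfib : (Finset.univ.filter fun σ : Equiv.Perm V =>
        MovesAlong G σ ∧ σ.support.card = i).filter (fun τ => tracedSubgraph G τ = H) =
          Finset.univ.filter fun τ => Traces τ H := by
      ext τ
      simp only [Finset.mem_filter, Finset.mem_univ, true_and]
      constructor
      · rintro ⟨⟨hτ, -⟩, rfl⟩
        exact hτ.traces
      · intro hτ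
        exact ⟨⟨hτ.movesAlong, hτ.card_support.trans hcard⟩, hτ.eq_tracedSubgraph.symm⟩
    rw [hfib, Finset.sum_congr rfl (g := fun _ => 1 - (-1 : ℝ) ^ sCount H)]
    · rw [Finset.sum_const, nsmul_eq_mul, ← Fintype.card_subtype, ← Nat.card_eq_fintype_card,
        hσ.card_traces]
      push_cast
      rfl
    · intro τ hτ
      rw [← (Finset.mem_filter.1 hτ).2.eq_tracedSubgraph]
  · intro σ hσ
    obtain ⟨-, hσ, hcard⟩ := Finset.mem_filter.1 hσ
    exact Finset.mem_filter.2
      ⟨Finset.mem_univ _, hσ.traces.isSachs, hσ.traces.card_support.symm.trans hcard⟩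

theorem finsum_odd_finsum_fiber {α : Type*} [Fintype α] (p : α → Prop) [DecidablePred p]
    (s t : α → ℕ) :
    ∑ᶠ j ∈ {j : ℕ | Odd j}, (2 : ℝ) ^ (j + 1) * ∑ᶠ a ∈ {a | p a ∧ s a = j}, (2 : ℝ) ^ t a =
      ∑ a with p a, 2 ^ (s a + t a) * (1 - (-1 : ℝ) ^ s a) := by
  have hinner : ∀ j, ∑ᶠ a ∈ {a | p a ∧ s a = j}, (2 : ℝ) ^ t a =
      ∑ a ∈ Finset.univ.filter p with s a = j, (2 : ℝ) ^ t a := by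
    intro j
    rw [← finsum_mem_coe_finset]
    simp
  simp_rw [hinner]
  have houter : ∑ᶠ j ∈ {j : ℕ | Odd j}, (2 : ℝ) ^ (j + 1) *
        ∑ a ∈ Finset.univ.filter p with s a = j, (2 : ℝ) ^ t a =
      ∑ j ∈ (Finset.univ.image s).filter Odd, (2 : ℝ) ^ (j + 1) *
        ∑ a ∈ Finset.univ.filter p with s a = j, (2 : ℝ) ^ t a := by
    refine finsum_mem_eq_sum_of_inter_support_eq _ ?_
    ext j
    simp only [Set.mem_inter_iff, Set.mem_ofPred_eq, Function.mem_support, Finset.coe_filter,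
      Finset.mem_image, Finset.mem_univ, true_and]
    constructor
    · rintro ⟨hj, hne⟩
      obtain ⟨a, ha, -⟩ := Finset.exists_ne_zero_of_sum_ne_zero (right_ne_zero_of_mul hne)
      exact ⟨⟨⟨a, (Finset.mem_filter.1 ha).2⟩, hj⟩, hne⟩
    · rintro ⟨⟨-, hj⟩, hne⟩
      exact ⟨hj, hne⟩
  rw [houter, Finset.sum_filter, ← Finset.sum_fiberwise_of_maps_to (g := s)
    (t := Finset.univ.image s) fun a _ => Finset.mem_image_of_mem s (Finset.mem_univ a)]
  refine Finset.sum_congr rfl fun j _ => ?_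
  have hterm : ∀ a ∈ (Finset.univ.filter p).filter (fun a => s a = j),
      (2 : ℝ) ^ (s a + t a) * (1 - (-1 : ℝ) ^ s a) =
        (2 ^ j * (1 - (-1 : ℝ) ^ j)) * 2 ^ t a := by
    intro a ha
    rw [(Finset.mem_filter.1 ha).2, pow_add]
    ring
  rw [Finset.sum_congr rfl hterm, ← Finset.mul_sum]
  split_ifs with hj
  · rw [hj.neg_one_pow]
    ring
  · rw [(Nat.not_odd_iff_even.1 hj).neg_one_pow]
    ring

end Counting

/-- Lemma on `f_i`. For a bipartite graph `G` on `n` vertices and each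
nonnegative even `i ≤ n`, `f_i = b_i - (-1)^{i/2} a_i` equals
`∑_{j odd} 2^{j+1} ∑_{U_i with exactly j cycles of length ≡ 0 mod 4} 2^{t(U_i)}`,
where `U_i` ranges over Sachs subgraphs of `G` on `i` vertices and `t(U_i)` is the number
of cycle components of `U_i` of length ≡ 2 mod 4. -/
theorem stmt_4 {V : Type*} [Fintype V] (G : SimpleGraph V) (hbip : G.Colorable 2)
    (i : ℕ) (hi : Even i) (hin : i ≤ Fintype.card V) :
    (permPolyG ℝ G).coeff (Fintype.card V - i)
        - (-1 : ℝ) ^ (i / 2) * (charPolyG ℝ G).coeff (Fintype.card V - i)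
      = ∑ᶠ j ∈ {j : ℕ | Odd j},
          (2 : ℝ) ^ (j + 1) *
            ∑ᶠ H ∈ {H : G.Subgraph | IsSachs H ∧ H.verts.ncard = i ∧ sCount H = j},
              (2 : ℝ) ^ tCount H := by
  rw [coeff_permPolyG_sub_coeff_charPolyG G hbip hi hin, sum_movesAlong_eq_sum_isSachs G hbip i,
    ← finsum_odd_finsum_fiber]
  simp only [and_assoc]

end
end
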